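/- arXiv:2207.04644 — 2 statements merged into one kernel-verified Lean document; each statement's English description precedes it below -/
import Mathlib

section
/- For all τ in the complex upper half-plane and all z ∈ ℂ: θ_{0,1}(τ,z)² = (1/2)·η(τ)·[ (η(τ)²/(η(τ/2)η(2τ)))²·ϑ00(τ,z) + (η(τ/2)/η(τ))²·ϑ01(τ,z) ]. -/
open Complex

/-- Jacobi theta function `θ_{j,m}(τ,z) = Σ_{n ∈ j/(2m)+ℤ} q^{m n²} e^{2πi m n z}`. -/
noncomputable def jTheta (j m : ℝ) (τ z : ℂ) : ℂ :=
  ∑' n : ℤ, Complex.exp (2 * (Real.pi : ℂ) * Complex.I * (m : ℂ) *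
    (((j / (2 * m) + (n : ℝ) : ℝ) : ℂ) ^ 2 * τ + ((j / (2 * m) + (n : ℝ) : ℝ) : ℂ) * z))

/-- `q^a := e^{2πiaτ}`. -/
noncomputable def qpow (τ : ℂ) (a : ℝ) : ℂ :=
  Complex.exp (2 * (Real.pi : ℂ) * Complex.I * (a : ℂ) * τ)

/-- Dedekind eta function. -/
noncomputable def dedekindEta (τ : ℂ) : ℂ :=
  Complex.exp ((Real.pi : ℂ) * Complex.I * τ / 12) *
    ∏' n : ℕ, (1 - Complex.exp (2 * (Real.pi : ℂ) * Complex.I * ((n : ℂ) + 1) * τ))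

/-- Mumford theta `ϑ00`. -/
noncomputable def v00 (τ z : ℂ) : ℂ := jTheta 0 2 τ z + jTheta 2 2 τ z
/-- Mumford theta `ϑ01`. -/
noncomputable def v01 (τ z : ℂ) : ℂ := jTheta 0 2 τ z - jTheta 2 2 τ z
/-- Mumford theta `ϑ10`. -/
noncomputable def v10 (τ z : ℂ) : ℂ := jTheta 1 2 τ z + jTheta (-1) 2 τ z

open Filter Topology

/-- The reciprocal `1 / (q; q)ₖ` of the `q`-Pochhammer symbol, extended by zero to `k < 0`. -/
noncomputable def invQPochhammer (q : ℂ) (k : ℤ) : ℂ :=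
  if 0 ≤ k then (∏ i ∈ Finset.range k.toNat, (1 - q ^ (i + 1)))⁻¹ else 0

lemma one_sub_pow_succ_ne_zero {q : ℂ} (hq : ‖q‖ < 1) (k : ℕ) : 1 - q ^ (k + 1) ≠ 0 := by
  intro h
  have h1 : ‖q‖ ^ (k + 1) = 1 := by
    rw [← norm_pow, ← sub_eq_zero.mp h, norm_one]
  exact (pow_lt_one₀ (norm_nonneg q) hq k.succ_ne_zero).ne h1

lemma invQPochhammer_sub_one {q : ℂ} (hq : ‖q‖ < 1) (k : ℤ) :
    invQPochhammer q (k - 1) = (1 - q ^ k) * invQPochhammer q k := by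
  rcases lt_trichotomy k 0 with hk | rfl | hk
  · simp [invQPochhammer, hk.not_ge, show ¬ 1 ≤ k by lia]
  · simp [invQPochhammer]
  · obtain ⟨n, rfl⟩ : ∃ n : ℕ, k = n + 1 := ⟨(k - 1).toNat, by lia⟩
    have h := one_sub_pow_succ_ne_zero hq n
    have hn : ((n : ℤ) + 1).toNat = n + 1 := by lia
    have hz : q ^ ((n : ℤ) + 1) = q ^ (n + 1) := by exact_mod_cast zpow_natCast q (n + 1)
    simp only [invQPochhammer, add_sub_cancel_right, hn, Int.toNat_natCast, hz,
      Finset.prod_range_succ, mul_inv]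
    rw [if_pos (by lia), if_pos (by lia), mul_left_comm, mul_inv_cancel₀ h, mul_one]

lemma tprod_one_sub_pow_ne_zero {q : ℂ} (hq : ‖q‖ < 1) : ∏' n : ℕ, (1 - q ^ (n + 1)) ≠ 0 := by
  simp only [sub_eq_add_neg]
  refine tprod_one_add_ne_zero_of_summable (f := fun n ↦ -q ^ (n + 1)) ?_ ?_
  · simpa only [← sub_eq_add_neg] using one_sub_pow_succ_ne_zero hq
  · simpa using (summable_nat_add_iff 1).mpr (summable_geometric_of_lt_one (norm_nonneg _) hq)

lemma tendsto_invQPochhammer {q : ℂ} (hq : ‖q‖ < 1) :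
    Tendsto (invQPochhammer q) atTop (𝓝 (∏' n : ℕ, (1 - q ^ (n + 1)))⁻¹) := by
  have h := ((ModularForm.multipliable_one_sub_pow hq).tendsto_prod_tprod_nat.inv₀
    (tprod_one_sub_pow_ne_zero hq)).comp
    (tendsto_atTop.mpr fun n ↦ (eventually_ge_atTop (n : ℤ)).mono fun k (hk : n ≤ k) ↦ (by lia : n ≤ k.toNat))
  refine h.congr' ?_
  filter_upwards [eventually_ge_atTop 0] with k hk
  simp [invQPochhammer, hk]

lemma exists_norm_invQPochhammer_le {q : ℂ} (hq : ‖q‖ < 1) :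
    ∃ C, ∀ k, ‖invQPochhammer q k‖ ≤ C := by
  obtain ⟨C, hC⟩ := ((ModularForm.multipliable_one_sub_pow hq).tendsto_prod_tprod_nat.inv₀
    (tprod_one_sub_pow_ne_zero hq)).norm.bddAbove_range
  refine ⟨C, fun k ↦ ?_⟩
  have hk := hC (Set.mem_range_self k.toNat)
  rw [invQPochhammer]
  split_ifs
  · exact hk
  · simpa using (norm_nonneg _).trans hk

/-- The finite form of the Jacobi triple product. -/
lemma hasSum_finite_jacobi_triple_product {q z : ℂ} (hq0 : q ≠ 0) (hq : ‖q‖ < 1) (hz : z ≠ 0)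
    (N : ℕ) :
    HasSum (fun j : ℤ ↦ q ^ (j ^ 2) * z ^ j *
        (invQPochhammer (q ^ 2) (N - j) * invQPochhammer (q ^ 2) (N + j)))
      ((∏ k ∈ Finset.range N, (1 + z * q ^ (2 * k + 1)) * (1 + z⁻¹ * q ^ (2 * k + 1))) *
        invQPochhammer (q ^ 2) (2 * N)) := by
  have hQ : ‖q ^ 2‖ < 1 := by simpa using pow_lt_one₀ (norm_nonneg q) hq two_ne_zero
  induction N with
  | zero =>
    convert hasSum_single (0 : ℤ) ?_ using 1
    · simp [invQPochhammer]
    · intro j hj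
      rcases hj.lt_or_gt with h | h <;> simp [invQPochhammer, h.not_ge]
  | succ N ih =>
    have h1 := one_sub_pow_succ_ne_zero hQ (2 * N)
    have h2 := one_sub_pow_succ_ne_zero hQ (2 * N + 1)
    have hl := ((Equiv.subRight (1 : ℤ)).hasSum_iff.mpr ih).mul_left (z * q ^ (2 * N + 1))
    have hr := ((Equiv.addRight (1 : ℤ)).hasSum_iff.mpr ih).mul_left (z⁻¹ * q ^ (2 * N + 1))
    have key := (((ih.mul_left (1 + q ^ (4 * N + 2))).add hl).add hr).mul_left
      ((1 - (q ^ 2) ^ (2 * N + 1)) * (1 - (q ^ 2) ^ (2 * N + 1 + 1)))⁻¹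
    refine (congrArg₂ (HasSum · ·) (funext fun j ↦ ?_) ?_).mpr key
    · rw [eq_inv_mul_iff_mul_eq₀ (mul_ne_zero h1 h2)]
      have hA := invQPochhammer_sub_one hQ (N + 1 - j)
      have hA' := invQPochhammer_sub_one hQ (N + 1 - j - 1)
      have hB := invQPochhammer_sub_one hQ (N + 1 + j)
      have hB' := invQPochhammer_sub_one hQ (N + 1 + j - 1)
      rw [hA, zpow_sub_one₀ (pow_ne_zero 2 hq0)] at hA'
      rw [hB, zpow_sub_one₀ (pow_ne_zero 2 hq0)] at hB'
      simp only [Function.comp_apply, Equiv.subRight_apply, Equiv.coe_addRight]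
      push_cast
      rw [show (N : ℤ) - j = N + 1 - j - 1 by ring, show (N : ℤ) + j = N + 1 + j - 1 by ring,
        show (N : ℤ) - (j - 1) = N + 1 - j by ring,
        show (N : ℤ) + (j - 1) = N + 1 + j - 1 - 1 by ring,
        show (N : ℤ) - (j + 1) = N + 1 - j - 1 - 1 by ring,
        show (N : ℤ) + (j + 1) = N + 1 + j by ring, hA', hB', hA, hB]
      have e1 : z * q ^ (2 * N + 1) * (q ^ ((j - 1) ^ 2) * z ^ (j - 1)) =
          q ^ (j ^ 2) * z ^ j * (q ^ 2) ^ ((N : ℤ) + 1 - j) := by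
        have : q ^ (2 * N + 1) * q ^ ((j - 1) ^ 2) =
            q ^ (j ^ 2) * (q ^ 2) ^ ((N : ℤ) + 1 - j) := by
          rw [← zpow_natCast q (2 * N + 1), ← zpow_natCast q 2, ← zpow_mul, ← zpow_add₀ hq0,
            ← zpow_add₀ hq0]
          congr 1
          push_cast
          ring
        rw [zpow_sub_one₀ hz]
        linear_combination (z ^ j * (z * z⁻¹)) * this +
          q ^ (j ^ 2) * z ^ j * (q ^ 2) ^ ((N : ℤ) + 1 - j) * mul_inv_cancel₀ hz
      have e2 : z⁻¹ * q ^ (2 * N + 1) * (q ^ ((j + 1) ^ 2) * z ^ (j + 1)) =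
          q ^ (j ^ 2) * z ^ j * (q ^ 2) ^ ((N : ℤ) + 1 + j) := by
        have : q ^ (2 * N + 1) * q ^ ((j + 1) ^ 2) =
            q ^ (j ^ 2) * (q ^ 2) ^ ((N : ℤ) + 1 + j) := by
          rw [← zpow_natCast q (2 * N + 1), ← zpow_natCast q 2, ← zpow_mul, ← zpow_add₀ hq0,
            ← zpow_add₀ hq0]
          congr 1
          push_cast
          ring
        rw [zpow_add_one₀ hz]
        linear_combination (z ^ j * (z * z⁻¹)) * this +
          q ^ (j ^ 2) * z ^ j * (q ^ 2) ^ ((N : ℤ) + 1 + j) * mul_inv_cancel₀ hz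
      have e3 : (q ^ 2) ^ ((N : ℤ) + 1 - j) * (q ^ 2) ^ ((N : ℤ) + 1 + j) = q ^ (4 * N + 4) := by
        rw [← zpow_add₀ (pow_ne_zero 2 hq0), ← zpow_natCast q 2, ← zpow_mul, ← zpow_natCast q]
        congr 1
        push_cast
        ring
      rw [← mul_assoc (z * q ^ (2 * N + 1)), ← mul_assoc (z⁻¹ * q ^ (2 * N + 1)), e1, e2]
      have e4 : q ^ (4 * N + 2) = (q ^ 2) ^ ((N : ℤ) + 1 - j) * (q ^ 2) ^ ((N : ℤ) + 1 + j) *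
          (q ^ 2)⁻¹ := by
        rw [e3, eq_mul_inv_iff_mul_eq₀ (pow_ne_zero 2 hq0)]
        ring
      rw [show (q ^ 2) ^ (2 * N + 1) = q ^ (4 * N + 2) by ring,
        show (q ^ 2) ^ (2 * N + 1 + 1) = q ^ (4 * N + 4) by ring, e4, ← e3]
      ring
    · rw [eq_inv_mul_iff_mul_eq₀ (mul_ne_zero h1 h2), Finset.prod_range_succ]
      have hC := invQPochhammer_sub_one hQ (2 * ((N + 1 : ℕ) : ℤ))
      have hC' := invQPochhammer_sub_one hQ (2 * ((N + 1 : ℕ) : ℤ) - 1)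
      rw [hC, show 2 * ((N + 1 : ℕ) : ℤ) - 1 - 1 = 2 * (N : ℤ) by push_cast; ring] at hC'
      rw [hC', show 2 * ((N + 1 : ℕ) : ℤ) - 1 = ((2 * N + 1 : ℕ) : ℤ) by push_cast; ring,
        show 2 * ((N + 1 : ℕ) : ℤ) = ((2 * N + 1 + 1 : ℕ) : ℤ) by push_cast; ring,
        zpow_natCast, zpow_natCast]
      have hzz := mul_inv_cancel₀ hz
      generalize ∏ k ∈ Finset.range N, (1 + z * q ^ (2 * k + 1)) * (1 + z⁻¹ * q ^ (2 * k + 1)) = P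
      generalize invQPochhammer (q ^ 2) ((2 * N + 1 + 1 : ℕ) : ℤ) = G
      linear_combination (P * G * (1 - (q ^ 2) ^ (2 * N + 1)) * (1 - (q ^ 2) ^ (2 * N + 1 + 1)) *
        q ^ (4 * N + 2)) * hzz

lemma norm_exp_pi_mul_I_mul_lt_one {τ : ℂ} (hτ : 0 < τ.im) : ‖cexp (Real.pi * I * τ)‖ < 1 := by
  rw [norm_exp, Real.exp_lt_one_iff]
  simpa using mul_pos Real.pi_pos hτ

lemma jacobiTheta₂_term_eq_zpow (j : ℤ) (w τ : ℂ) :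
    jacobiTheta₂_term j w τ = cexp (Real.pi * I * τ) ^ (j ^ 2) * cexp (2 * Real.pi * I * w) ^ j := by
  rw [← exp_int_mul, ← exp_int_mul, ← exp_add, jacobiTheta₂_term]
  congr 1
  push_cast
  ring

lemma multipliable_one_add_mul_pow_odd {q : ℂ} (hq : ‖q‖ < 1) (z : ℂ) :
    Multipliable fun n : ℕ ↦ 1 + z * q ^ (2 * n + 1) := by
  refine multipliable_one_add_of_summable ?_
  have h : Summable fun n : ℕ ↦ ‖z‖ * ‖q‖ ^ n :=
    (summable_geometric_of_lt_one (norm_nonneg _) hq).mul_left _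
  refine (h.comp_injective (i := fun n : ℕ ↦ 2 * n + 1) fun a b hab ↦ by simpa using hab).congr
    fun n ↦ ?_
  simp

/-- The Jacobi triple product identity. -/
theorem jacobiTheta₂_eq_tprod (w : ℂ) {τ : ℂ} (hτ : 0 < τ.im) :
    jacobiTheta₂ w τ = (∏' n : ℕ, (1 - (cexp (Real.pi * I * τ) ^ 2) ^ (n + 1))) *
      ((∏' n : ℕ, (1 + cexp (2 * Real.pi * I * w) * cexp (Real.pi * I * τ) ^ (2 * n + 1))) *
        ∏' n : ℕ, (1 + (cexp (2 * Real.pi * I * w))⁻¹ * cexp (Real.pi * I * τ) ^ (2 * n + 1))) := by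
  have hq := norm_exp_pi_mul_I_mul_lt_one hτ
  have hsum := hasSum_jacobiTheta₂_term w hτ
  simp only [jacobiTheta₂_term_eq_zpow] at hsum
  have hq0 := exp_ne_zero (Real.pi * I * τ)
  have hz := exp_ne_zero (2 * Real.pi * I * w)
  generalize cexp (Real.pi * I * τ) = q at *
  generalize cexp (2 * Real.pi * I * w) = z at *
  have hQ : ‖q ^ 2‖ < 1 := by simpa using pow_lt_one₀ (norm_nonneg q) hq two_ne_zero
  have hE := tprod_one_sub_pow_ne_zero hQ
  have hlim := tendsto_invQPochhammer hQ
  obtain ⟨C, hC⟩ := exists_norm_invQPochhammer_le hQ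
  generalize ∏' n : ℕ, (1 - (q ^ 2) ^ (n + 1)) = E at *
  have hsub (j : ℤ) : Tendsto (fun N : ℕ ↦ (N : ℤ) - j) atTop atTop :=
    tendsto_atTop_add_const_right _ (-j) tendsto_natCast_atTop_atTop
  have hadd (j : ℤ) : Tendsto (fun N : ℕ ↦ (N : ℤ) + j) atTop atTop :=
    tendsto_atTop_add_const_right _ j tendsto_natCast_atTop_atTop
  have hleft := tendsto_tsum_of_dominated_convergence (𝓕 := atTop)
    (f := fun (N : ℕ) (j : ℤ) ↦ q ^ (j ^ 2) * z ^ j *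
        (invQPochhammer (q ^ 2) (N - j) * invQPochhammer (q ^ 2) (N + j)))
    (g := fun j ↦ q ^ (j ^ 2) * z ^ j * (E⁻¹ * E⁻¹)) (hsum.summable.norm.mul_right (C * C))
    (fun j ↦ ((hlim.comp (hsub j)).mul (hlim.comp (hadd j))).const_mul _)
    (.of_forall fun N j ↦ by
      rw [norm_mul _ (_ * _), norm_mul (invQPochhammer _ _)]
      gcongr
      · exact (norm_nonneg _).trans (hC 0)
      · exact hC _
      · exact hC _)
  rw [tsum_mul_right, hsum.tsum_eq] at hleft
  have h2N : Tendsto (fun N : ℕ ↦ 2 * (N : ℤ)) atTop atTop :=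
    tendsto_natCast_atTop_atTop.const_mul_atTop' two_pos
  have hright := ((multipliable_one_add_mul_pow_odd hq z).tendsto_prod_tprod_nat.mul
    (multipliable_one_add_mul_pow_odd hq z⁻¹).tendsto_prod_tprod_nat).mul (hlim.comp h2N)
  have h := tendsto_nhds_unique hleft (hright.congr fun N ↦ by
    rw [(hasSum_finite_jacobi_triple_product hq0 hq hz N).tsum_eq, Finset.prod_mul_distrib]
    rfl)
  generalize ∏' n : ℕ, (1 + z * q ^ (2 * n + 1)) = A at *
  generalize ∏' n : ℕ, (1 + z⁻¹ * q ^ (2 * n + 1)) = B at *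
  field_simp at h
  rw [h, mul_assoc]

lemma jacobiTheta₂_term_add_half (n : ℤ) (w τ : ℂ) :
    jacobiTheta₂_term n (w + 1 / 2) τ = (-1) ^ n * jacobiTheta₂_term n w τ := by
  rw [← exp_pi_mul_I, ← exp_int_mul, jacobiTheta₂_term, jacobiTheta₂_term, ← exp_add]
  congr 1
  ring

lemma hasSum_jacobiTheta₂_term_mul (a b : ℂ) {τ : ℂ} (hτ : 0 < τ.im) :
    HasSum (fun p : ℤ × ℤ ↦ jacobiTheta₂_term p.1 a τ * jacobiTheta₂_term p.2 b τ)
      (jacobiTheta₂ a τ * jacobiTheta₂ b τ) := by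
  have hnorm (c : ℂ) : Summable fun n ↦ ‖jacobiTheta₂_term n c τ‖ :=
    ((summable_jacobiTheta₂_term_iff c τ).mpr hτ).norm
  rw [jacobiTheta₂, jacobiTheta₂, tsum_mul_tsum_of_summable_norm (hnorm a) (hnorm b)]
  exact (summable_mul_of_summable_norm (hnorm a) (hnorm b)).hasSum

/-- The square of a theta function of modulus `2τ` in terms of theta functions of modulus `τ`. -/
lemma jacobiTheta₂_two_mul_sq (z : ℂ) {τ : ℂ} (hτ : 0 < τ.im) :
    jacobiTheta₂ z (2 * τ) ^ 2 = (1 / 2) * (jacobiTheta₂ 0 τ * jacobiTheta₂ z τ +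
      jacobiTheta₂ (1 / 2) τ * jacobiTheta₂ (z + 1 / 2) τ) := by
  have hτ2 : 0 < (2 * τ).im := by simpa using hτ
  have hr := ((hasSum_jacobiTheta₂_term_mul 0 z hτ).add
    (hasSum_jacobiTheta₂_term_mul (1 / 2) (z + 1 / 2) hτ)).mul_left (1 / 2)
  have hinj : Function.Injective fun p : ℤ × ℤ ↦ (p.1 - p.2, p.1 + p.2) := by
    rintro ⟨a, b⟩ ⟨c, d⟩ h
    simp only [Prod.mk.injEq] at h ⊢
    lia
  have hfun (p : ℤ × ℤ) : 1 / 2 * (jacobiTheta₂_term p.1 0 τ * jacobiTheta₂_term p.2 z τ +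
      jacobiTheta₂_term p.1 (1 / 2) τ * jacobiTheta₂_term p.2 (z + 1 / 2) τ) =
      1 / 2 * (1 + (-1) ^ (p.1 + p.2)) *
        (jacobiTheta₂_term p.1 0 τ * jacobiTheta₂_term p.2 z τ) := by
    have h0 := jacobiTheta₂_term_add_half p.1 0 τ
    rw [zero_add] at h0
    rw [h0, jacobiTheta₂_term_add_half, zpow_add₀ (by norm_num)]
    ring
  simp only [hfun] at hr
  rw [← hinj.hasSum_iff] at hr
  · rw [pow_two]
    refine (hasSum_jacobiTheta₂_term_mul z z hτ2).unique ((congrArg (HasSum · _) (funext fun p ↦ ?_)).mpr hr)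
    have heven : Even (p.1 - p.2 + (p.1 + p.2)) := ⟨p.1, by ring⟩
    simp only [Function.comp_apply, heven.neg_one_zpow, jacobiTheta₂_term, ← exp_add]
    norm_num
    ring_nf
  · rintro ⟨m, n⟩ hmn
    have hodd : Odd (m + n) := by
      rw [← Int.not_even_iff_odd]
      rintro ⟨k, hk⟩
      exact hmn ⟨(k, n - k), Prod.ext (by simp; lia) (by simp)⟩
    simp [hodd.neg_one_zpow]

lemma jTheta_zero_one (τ z : ℂ) : jTheta 0 1 τ z = jacobiTheta₂ z (2 * τ) := by
  refine tsum_congr fun n ↦ ?_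
  rw [jacobiTheta₂_term]
  congr 1
  push_cast
  ring

lemma hasSum_jTheta_two_even {τ : ℂ} (hτ : 0 < τ.im) (z : ℂ) :
    HasSum (fun n : ℤ ↦ jacobiTheta₂_term (2 * n) z τ) (jTheta 0 2 τ z) := by
  have h := ((hasSum_jacobiTheta₂_term z hτ).summable.comp_injective
    (mul_right_injective₀ (two_ne_zero (α := ℤ)))).hasSum
  refine (congrArg (HasSum _ ·) (tsum_congr fun n ↦ ?_)).mpr h
  rw [Function.comp_apply, jacobiTheta₂_term]
  congr 1
  push_cast
  ring

lemma hasSum_jTheta_two_odd {τ : ℂ} (hτ : 0 < τ.im) (z : ℂ) :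
    HasSum (fun n : ℤ ↦ jacobiTheta₂_term (2 * n + 1) z τ) (jTheta 2 2 τ z) := by
  have h := ((hasSum_jacobiTheta₂_term z hτ).summable.comp_injective
    ((add_left_injective (1 : ℤ)).comp (mul_right_injective₀ (two_ne_zero (α := ℤ))))).hasSum
  refine (congrArg (HasSum _ ·) (tsum_congr fun n ↦ ?_)).mpr h
  rw [Function.comp_apply, Function.comp_apply, jacobiTheta₂_term]
  congr 1
  push_cast
  ring

lemma HasSum.int_even_add_odd {f : ℤ → ℂ} {a b : ℂ} (he : HasSum (fun n ↦ f (2 * n)) a)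
    (ho : HasSum (fun n ↦ f (2 * n + 1)) b) : HasSum f (a + b) := by
  have hinj := mul_right_injective₀ (two_ne_zero' ℤ)
  replace ho := ((add_left_injective 1).comp hinj).hasSum_range_iff.2 ho
  refine (hinj.hasSum_range_iff.2 he).add_isCompl ?_ ho
  simpa [Function.comp_def] using Int.isCompl_even_odd

lemma v00_eq_jacobiTheta₂ {τ : ℂ} (hτ : 0 < τ.im) (z : ℂ) : v00 τ z = jacobiTheta₂ z τ :=
  (HasSum.int_even_add_odd (f := (jacobiTheta₂_term · z τ)) (hasSum_jTheta_two_even hτ z)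
    (hasSum_jTheta_two_odd hτ z)).unique (hasSum_jacobiTheta₂_term z hτ)

lemma v01_eq_jacobiTheta₂ {τ : ℂ} (hτ : 0 < τ.im) (z : ℂ) :
    v01 τ z = jacobiTheta₂ (z + 1 / 2) τ := by
  rw [v01, sub_eq_add_neg]
  refine (HasSum.int_even_add_odd (f := (jacobiTheta₂_term · (z + 1 / 2) τ)) ?_ ?_).unique
    (hasSum_jacobiTheta₂_term (z + 1 / 2) hτ)
  · simpa only [jacobiTheta₂_term_add_half, (even_two_mul _).neg_one_zpow, one_mul] using
      hasSum_jTheta_two_even hτ z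
  · simpa only [jacobiTheta₂_term_add_half, (odd_two_mul_add_one _).neg_one_zpow, neg_one_mul]
      using (hasSum_jTheta_two_odd hτ z).neg

lemma multipliable_one_sub_pow_odd {q : ℂ} (hq : ‖q‖ < 1) :
    Multipliable fun n : ℕ ↦ 1 - q ^ (2 * n + 1) := by
  simpa [← sub_eq_add_neg] using multipliable_one_add_mul_pow_odd hq (-1)

lemma tprod_one_sub_pow_eq {q : ℂ} (hq : ‖q‖ < 1) :
    ∏' n : ℕ, (1 - q ^ (n + 1)) =
      (∏' n : ℕ, (1 - q ^ (2 * n + 1))) * ∏' n : ℕ, (1 - (q ^ 2) ^ (n + 1)) := by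
  have hq2 : ‖q ^ 2‖ < 1 := by simpa using pow_lt_one₀ (norm_nonneg q) hq two_ne_zero
  have hpow (n : ℕ) : (q ^ 2) ^ (n + 1) = q ^ (2 * n + 1 + 1) := by ring
  have h := ModularForm.multipliable_one_sub_pow hq2
  simp only [hpow] at h ⊢
  exact (tprod_even_mul_odd (f := fun n ↦ 1 - q ^ (n + 1)) (multipliable_one_sub_pow_odd hq)
    h).symm

lemma tprod_one_sub_sq_pow_odd {q : ℂ} (hq : ‖q‖ < 1) :
    ∏' n : ℕ, (1 - (q ^ 2) ^ (2 * n + 1)) =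
      (∏' n : ℕ, (1 + q ^ (2 * n + 1))) * ∏' n : ℕ, (1 - q ^ (2 * n + 1)) := by
  have h := multipliable_one_add_mul_pow_odd hq 1
  simp only [one_mul] at h
  rw [← h.tprod_mul (multipliable_one_sub_pow_odd hq)]
  exact tprod_congr fun n ↦ by ring

lemma dedekindEta_eq (τ : ℂ) :
    dedekindEta τ = cexp (Real.pi * I * τ / 12) *
      ∏' n : ℕ, (1 - cexp (2 * Real.pi * I * τ) ^ (n + 1)) := by
  rw [dedekindEta]
  congr 1
  refine tprod_congr fun n ↦ ?_
  rw [← exp_nat_mul]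
  push_cast
  ring_nf

/-- Note 2.4 (1): `θ_{0,1}(τ,z)²`. -/
theorem stmt_10 (τ : ℂ) (hτ : 0 < τ.im) (z : ℂ) :
    jTheta 0 1 τ z ^ 2 =
      (1 / 2) * dedekindEta τ *
        ((dedekindEta τ ^ 2 / (dedekindEta (τ / 2) * dedekindEta (2 * τ))) ^ 2 * v00 τ z
          + (dedekindEta (τ / 2) / dedekindEta τ) ^ 2 * v01 τ z) := by
  have hq := norm_exp_pi_mul_I_mul_lt_one hτ
  have hq2 : ‖cexp (Real.pi * I * τ) ^ 2‖ < 1 := by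
    simpa using pow_lt_one₀ (norm_nonneg _) hq two_ne_zero
  have h1 := tprod_one_sub_pow_eq hq
  have h2 := tprod_one_sub_pow_eq hq2
  rw [tprod_one_sub_sq_pow_odd hq] at h2
  have hF := tprod_one_sub_pow_ne_zero hq2
  rw [h2] at hF
  have hhalf : cexp (2 * Real.pi * I * (1 / 2)) = -1 := by
    rw [← exp_pi_mul_I]
    ring_nf
  have e0 := dedekindEta_eq τ
  have e1 := dedekindEta_eq (τ / 2)
  have e2 := dedekindEta_eq (2 * τ)
  have x0 : cexp (Real.pi * I * τ / 12) = cexp (Real.pi * I * τ / 24) ^ 2 := by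
    rw [← exp_nat_mul]
    ring_nf
  have x1 : cexp (Real.pi * I * (τ / 2) / 12) = cexp (Real.pi * I * τ / 24) := by ring_nf
  have x2 : cexp (Real.pi * I * (2 * τ) / 12) = cexp (Real.pi * I * τ / 24) ^ 4 := by
    rw [← exp_nat_mul]
    ring_nf
  have y0 : cexp (2 * Real.pi * I * τ) = cexp (Real.pi * I * τ) ^ 2 := by
    rw [← exp_nat_mul]
    ring_nf
  have y1 : cexp (2 * Real.pi * I * (τ / 2)) = cexp (Real.pi * I * τ) := by ring_nf
  have y2 : cexp (2 * Real.pi * I * (2 * τ)) = (cexp (Real.pi * I * τ) ^ 2) ^ 2 := by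
    rw [← pow_mul, ← exp_nat_mul]
    ring_nf
  rw [x0, y0] at e0
  rw [x1, y1, h1] at e1
  rw [x2, y2] at e2
  rw [jTheta_zero_one, jacobiTheta₂_two_mul_sq z hτ, v00_eq_jacobiTheta₂ hτ,
    v01_eq_jacobiTheta₂ hτ, jacobiTheta₂_eq_tprod 0 hτ, jacobiTheta₂_eq_tprod (1 / 2) hτ, hhalf,
    e0, e1, e2]
  simp only [mul_zero, Complex.exp_zero, inv_neg, inv_one, one_mul, neg_mul, ← sub_eq_add_neg]
  have he := exp_ne_zero (Real.pi * I * τ / 24)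
  generalize cexp (Real.pi * I * τ / 24) = e at *
  generalize cexp (Real.pi * I * τ) = q at *
  rw [h2]
  generalize ∏' n : ℕ, (1 + q ^ (2 * n + 1)) = A at *
  generalize ∏' n : ℕ, (1 - q ^ (2 * n + 1)) = B at *
  generalize ∏' n : ℕ, (1 - ((q ^ 2) ^ 2) ^ (n + 1)) = F at *
  have hA : A ≠ 0 := by rintro rfl; simp at hF
  have hB : B ≠ 0 := by rintro rfl; simp at hF
  have hF4 : F ≠ 0 := by rintro rfl; simp at hF
  field_simp
end

section
/- For every integer m ≥ 1, all τ in the complex upper half-plane, and all z ∈ ℂ at which θ_{−1/2,1}(τ,z) ≠ 0 and θ_{1/2,1}(τ,z) ≠ 0: θ_{0,1}(τ,z)·[ θ_{1/2,m+1}(τ,z)/θ_{−1/2,1}(τ,z) − θ_{−1/2,m+1}(τ,z)/θ_{1/2,1}(τ,z) ] = Σ_{r=0}^{m+1} θ_{1/2−2r(m+1), (m+1)(m+2)}(τ,0)·[ θ_{1/2+2r, m+2}(τ,z)/θ_{−1/2,1}(τ,z) − θ_{−1/2−2r, m+2}(τ,z)/θ_{1/2,1}(τ,z) ] (the summand is independent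 of the choice of representative r modulo m+2). -/
open Complex

/-- The `n`-th term of the series defining `jTheta j m τ z`. -/
noncomputable def jThetaTerm (j m : ℝ) (τ z : ℂ) (n : ℤ) : ℂ :=
  Complex.exp (2 * (Real.pi : ℂ) * Complex.I * (m : ℂ) *
    (((j / (2 * m) + (n : ℝ) : ℝ) : ℂ) ^ 2 * τ + ((j / (2 * m) + (n : ℝ) : ℝ) : ℂ) * z))

lemma summable_norm_jThetaTerm (j m : ℝ) (hm : 0 < m) (τ z : ℂ) (hτ : 0 < τ.im) :
    Summable fun n : ℤ => ‖jThetaTerm j m τ z n‖ := by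
  have him : 0 < (2 * m * τ : ℂ).im := by
    have : (2 * m * τ : ℂ).im = 2 * m * τ.im := by simp
    rw [this]; positivity
  have h := ((summable_jacobiTheta₂_term_iff
    (2 * m * ((j / (2 * m) : ℝ) : ℂ) * τ + m * z) (2 * m * τ)).mpr him).mul_left
      (Complex.exp (2 * (Real.pi : ℂ) * Complex.I * (m : ℂ) *
        (((j / (2 * m) : ℝ) : ℂ) ^ 2 * τ + ((j / (2 * m) : ℝ) : ℂ) * z)))
  refine (h.congr fun n => ?_).norm
  rw [jThetaTerm, jacobiTheta₂_term, ← Complex.exp_add, Complex.ofReal_add, Complex.ofReal_intCast]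
  congr 1
  ring

lemma jTheta_neg (j m : ℝ) (τ z : ℂ) : jTheta j m τ (-z) = jTheta (-j) m τ z := by
  unfold jTheta
  rw [← (Equiv.neg ℤ).tsum_eq]
  refine tsum_congr fun n => ?_
  simp only [Equiv.neg_apply]
  congr 1
  push_cast
  ring

/-- The bijection `(k, k', s) ↦ (s + k - M k', k + k')` diagonalising the quadratic form
`a² + M n²`. -/
def latticeEquiv (M : ℕ) : ((ℤ × ℤ) × Fin (M + 1)) ≃ ℤ × ℤ where
  toFun p := ((p.2 : ℕ) + p.1.1 - M * p.1.2, p.1.1 + p.1.2)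
  invFun q := ((q.2 + (Int.divModEquiv (M + 1) (q.1 - q.2)).1,
    -(Int.divModEquiv (M + 1) (q.1 - q.2)).1), (Int.divModEquiv (M + 1) (q.1 - q.2)).2)
  left_inv := by
    rintro ⟨⟨k, l⟩, s⟩
    have h : ((s : ℕ) + k - M * l - (k + l) : ℤ) = (Int.divModEquiv (M + 1)).symm (-l, s) := by
      simp only [Int.divModEquiv_symm_apply]
      push_cast
      ring
    simp only [h, Equiv.apply_symm_apply]
    simp
  right_inv := by
    rintro ⟨a, n⟩
    have h := (Int.divModEquiv (M + 1)).symm_apply_apply (a - n)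
    simp only [Int.divModEquiv_symm_apply] at h
    push_cast at h
    ext
    · simp only
      linear_combination h
    · simp

lemma jThetaTerm_mul_jThetaTerm (j : ℝ) (M : ℕ) (hM : 0 < M) (τ z : ℂ) (k l : ℤ)
    (s : Fin (M + 1)) :
    jThetaTerm 0 1 τ z (latticeEquiv M ((k, l), s)).1 *
        jThetaTerm j M τ z (latticeEquiv M ((k, l), s)).2 =
      jThetaTerm (j + 2 * (s : ℕ)) (M + 1) τ z k *
        jThetaTerm (j - 2 * (s : ℕ) * M) (M * (M + 1)) τ 0 l := by
  simp only [jThetaTerm, latticeEquiv, Equiv.coe_fn_mk, ← Complex.exp_add]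
  congr 1
  have hM' : (M : ℂ) ≠ 0 := by exact_mod_cast hM.ne'
  have hN : (M : ℂ) + 1 ≠ 0 := by exact_mod_cast M.succ_ne_zero
  push_cast
  field_simp
  ring

/-- The product formula for `θ_{0,1} θ_{j,M}` with integral `M`. -/
lemma jTheta_zero_one_mul_jTheta (j : ℝ) (M : ℕ) (hM : 0 < M) (τ z : ℂ) (hτ : 0 < τ.im) :
    jTheta 0 1 τ z * jTheta j M τ z =
      ∑ r ∈ Finset.range (M + 1),
        jTheta (j - 2 * (r : ℝ) * M) (M * (M + 1)) τ 0 * jTheta (j + 2 * (r : ℝ)) (M + 1) τ z := by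
  have hM' : (0 : ℝ) < M := by exact_mod_cast hM
  have hf := summable_norm_jThetaTerm 0 1 one_pos τ z hτ
  have hg := summable_norm_jThetaTerm j M hM' τ z hτ
  have hs := (latticeEquiv M).summable_iff.mpr (summable_mul_of_summable_norm hf hg)
  rw [← (Equiv.prodComm _ _).summable_iff] at hs
  calc jTheta 0 1 τ z * jTheta j M τ z
      = (∑' n, jThetaTerm 0 1 τ z n) * ∑' n, jThetaTerm j M τ z n := rfl
    _ = ∑' p : Fin (M + 1) × (ℤ × ℤ), jThetaTerm 0 1 τ z (latticeEquiv M (p.2, p.1)).1 *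
          jThetaTerm j M τ z (latticeEquiv M (p.2, p.1)).2 := by
        rw [tsum_mul_tsum_of_summable_norm hf hg, ← (latticeEquiv M).tsum_eq,
          ← (Equiv.prodComm _ _).tsum_eq]
        rfl
    _ = ∑ s : Fin (M + 1), ∑' p : ℤ × ℤ, jThetaTerm 0 1 τ z (latticeEquiv M (p, s)).1 *
          jThetaTerm j M τ z (latticeEquiv M (p, s)).2 := by
        exact (Summable.tsum_prod hs).trans (tsum_fintype _)
    _ = ∑ s : Fin (M + 1), jTheta (j - 2 * ((s : ℕ) : ℝ) * M) (M * (M + 1)) τ 0 *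
          jTheta (j + 2 * ((s : ℕ) : ℝ)) (M + 1) τ z := by
        refine Finset.sum_congr rfl fun s _ => ?_
        rw [mul_comm]
        refine Eq.trans (tsum_congr fun p => jThetaTerm_mul_jThetaTerm j M hM τ z p.1 p.2 s) ?_
        exact (tsum_mul_tsum_of_summable_norm
          (summable_norm_jThetaTerm _ _ (by positivity) τ z hτ)
          (summable_norm_jThetaTerm _ _ (by positivity) τ 0 hτ)).symm
    _ = _ := Fin.sum_univ_eq_sum_range (fun r : ℕ =>
          jTheta (j - 2 * (r : ℝ) * M) (M * (M + 1)) τ 0 *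
          jTheta (j + 2 * (r : ℝ)) (M + 1) τ z) (M + 1)

/-- Note 5.4 1)(i). -/
theorem stmt_19 (m : ℕ) (hm : 1 ≤ m) (τ : ℂ) (hτ : 0 < τ.im) (z : ℂ)
    (h1 : jTheta (-(1 / 2)) 1 τ z ≠ 0) (h2 : jTheta (1 / 2) 1 τ z ≠ 0) :
    jTheta 0 1 τ z *
        (jTheta (1 / 2) ((m : ℝ) + 1) τ z / jTheta (-(1 / 2)) 1 τ z
          - jTheta (-(1 / 2)) ((m : ℝ) + 1) τ z / jTheta (1 / 2) 1 τ z) =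
      ∑ r ∈ Finset.range (m + 2),
        jTheta (1 / 2 - 2 * (r : ℝ) * ((m : ℝ) + 1)) (((m : ℝ) + 1) * ((m : ℝ) + 2)) τ 0 *
          (jTheta (1 / 2 + 2 * (r : ℝ)) ((m : ℝ) + 2) τ z / jTheta (-(1 / 2)) 1 τ z
            - jTheta (-(1 / 2) - 2 * (r : ℝ)) ((m : ℝ) + 2) τ z / jTheta (1 / 2) 1 τ z) := by
  have key := fun w => jTheta_zero_one_mul_jTheta (1 / 2) (m + 1) m.succ_pos τ w hτ
  have hN : ((m : ℝ) + 1) + 1 = m + 2 := by ring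
  push_cast at key
  simp only [hN] at key
  have hpos := key z
  have hneg := key (-z)
  simp only [jTheta_neg, neg_zero, neg_add, ← sub_eq_add_neg] at hneg
  rw [mul_sub, ← mul_div_assoc, ← mul_div_assoc, hpos, hneg, Finset.sum_div, Finset.sum_div,
    ← Finset.sum_sub_distrib]
  exact Finset.sum_congr rfl fun r _ => by ring
end
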